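/- Let d be a positive integer and σ₁, σ₂ > 0. Let u be a random vector in ℝᵈ with i.i.d. N(0, σ₁²) coordinates and let e be a random vector in ℝᵈ with i.i.d. N(0, σ₂²) coordinates, with u and e independent. Then for every δ ∈ (0, 1/10), the probability that |⟨u, e⟩| ≥ 10⁴ · σ₁ · σ₂ · √d · log²(d/δ) is at most δ. -/

import Mathlib

open MeasureTheory ProbabilityTheory Real
open scoped NNReal

lemma lintegral_exp_mul_gaussianReal (v : ℝ≥0) (s : ℝ) :
    ∫⁻ x, ENNReal.ofReal (exp (s * x)) ∂gaussianReal 0 v =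
      ENNReal.ofReal (exp (v * s ^ 2 / 2)) := by
  rw [← ofReal_integral_eq_lintegral_ofReal (integrable_exp_mul_gaussianReal s)
    (ae_of_all _ fun x => (exp_pos _).le)]
  have h := congrFun (mgf_fun_id_gaussianReal (μ := 0) (v := v)) s
  simp only [mgf, zero_mul, zero_add] at h
  rw [h]

lemma inv_sqrt_one_sub_le_exp {y : ℝ} (hy₀ : 0 ≤ y) (hy : y ≤ 1 / 2) :
    (√(1 - y))⁻¹ ≤ exp y := by
  have h1 : 1 ≤ exp y ^ 2 * (1 - y) := by
    have h2 : 2 * y + 1 ≤ exp y ^ 2 := by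
      rw [← exp_nat_mul]
      exact_mod_cast add_one_le_exp (2 * y)
    nlinarith
  rw [inv_le_iff_one_le_mul₀ (sqrt_pos.2 (by linarith))]
  calc (1 : ℝ) ≤ √(exp y ^ 2 * (1 - y)) := one_le_sqrt.2 h1
    _ = exp y * √(1 - y) := by rw [sqrt_mul (sq_nonneg _), sqrt_sq (exp_pos y).le]

lemma lintegral_exp_mul_sq_gaussianReal_le {v : ℝ≥0} (hv : v ≠ 0) {a : ℝ} (ha₀ : 0 ≤ a)
    (ha : 2 * a * v ≤ 1 / 2) :
    ∫⁻ x, ENNReal.ofReal (exp (a * x ^ 2)) ∂gaussianReal 0 v ≤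
      ENNReal.ofReal (exp (2 * a * v)) := by
  have hv' : (0 : ℝ) < v := by exact_mod_cast pos_iff_ne_zero.2 hv
  have hpos : 0 < 1 - 2 * a * v := by linarith
  obtain ⟨w, hw⟩ : ∃ w : ℝ≥0, (w : ℝ) = v / (1 - 2 * a * v) := ⟨⟨_, by positivity⟩, rfl⟩
  have hw' : (0 : ℝ) < w := hw ▸ div_pos hv' hpos
  have hw₀ : w ≠ 0 := (NNReal.coe_pos.1 hw').ne'
  have key (x : ℝ) : gaussianPDFReal 0 v x * exp (a * x ^ 2) =
      (√(1 - 2 * a * v))⁻¹ * gaussianPDFReal 0 w x := by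
    have h1 : 2 * π * v = (1 - 2 * a * v) * (2 * π * w) := by
      rw [hw, mul_div_assoc', mul_div_cancel₀ _ hpos.ne']
    have h2 : -(x - 0) ^ 2 / (2 * w) = -(x - 0) ^ 2 / (2 * v) + a * x ^ 2 := by
      have h3 : (v : ℝ) = w * (1 - 2 * a * v) := by rw [hw, div_mul_cancel₀ _ hpos.ne']
      field_simp
      linear_combination (-x ^ 2) * h3
    rw [gaussianPDFReal, gaussianPDFReal, h1, sqrt_mul hpos.le, h2, exp_add, mul_inv]
    ring
  rw [gaussianReal_of_var_ne_zero 0 hv,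
    lintegral_withDensity_eq_lintegral_mul _ (measurable_gaussianPDF 0 v) (by fun_prop)]
  calc ∫⁻ x, (gaussianPDF 0 v * fun x => ENNReal.ofReal (exp (a * x ^ 2))) x
      = ∫⁻ x, ENNReal.ofReal (√(1 - 2 * a * v))⁻¹ *
          ENNReal.ofReal (gaussianPDFReal 0 w x) := by
        refine lintegral_congr fun x => ?_
        rw [Pi.mul_apply, gaussianPDF, ← ENNReal.ofReal_mul (gaussianPDFReal_nonneg _ _ _), key,
          ENNReal.ofReal_mul (by positivity)]
    _ = ENNReal.ofReal (√(1 - 2 * a * v))⁻¹ := by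
        rw [lintegral_const_mul _ (measurable_gaussianPDFReal 0 w).ennreal_ofReal,
          lintegral_gaussianPDFReal_eq_one 0 hw₀, mul_one]
    _ ≤ _ := ENNReal.ofReal_le_ofReal (inv_sqrt_one_sub_le_exp (by positivity) ha)

lemma lintegral_pi_prod_eval {ι : Type*} [Fintype ι] (μ : Measure ℝ) [IsProbabilityMeasure μ]
    (f : ι → ℝ → ENNReal) (hf : ∀ i, Measurable (f i)) :
    ∫⁻ x, ∏ i, f i (x i) ∂Measure.pi (fun _ : ι => μ) = ∏ i, ∫⁻ x, f i x ∂μ := by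
  rw [lintegral_prod_eq_prod_lintegral_of_indepFun Finset.univ (fun i (x : ι → ℝ) => f i (x i))
    (iIndepFun_pi fun i => (hf i).aemeasurable)
    (fun i => (hf i).comp (measurable_pi_apply i))]
  refine Finset.prod_congr rfl fun i _ => ?_
  exact (measurePreserving_eval (fun _ : ι => μ) i).lintegral_comp (hf i)

/-- The moment generating function of the inner product of two independent centred Gaussian
vectors with independent coordinates of variances `v` and `w`. -/
lemma lintegral_exp_inner_gaussian_le {ι : Type*} [Fintype ι] (v : ℝ≥0) {w : ℝ≥0} (hw : w ≠ 0)
    {t : ℝ} (ht : v * w * t ^ 2 ≤ 1 / 2) :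
    ∫⁻ p : (ι → ℝ) × (ι → ℝ), ENNReal.ofReal (exp (t * ∑ j, p.1 j * p.2 j))
        ∂(Measure.pi fun _ => gaussianReal 0 v).prod (Measure.pi fun _ => gaussianReal 0 w) ≤
      ENNReal.ofReal (exp (Fintype.card ι * (v * w * t ^ 2))) := by
  rw [lintegral_prod_symm _ (by fun_prop)]
  have inner (y : ι → ℝ) :
      ∫⁻ x : ι → ℝ, ENNReal.ofReal (exp (t * ∑ j, x j * y j))
        ∂(Measure.pi fun _ => gaussianReal 0 v) =
      ∏ j, ENNReal.ofReal (exp ((v * t ^ 2 / 2) * y j ^ 2)) := by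
    have h (x : ι → ℝ) : ENNReal.ofReal (exp (t * ∑ j, x j * y j)) =
        ∏ j, ENNReal.ofReal (exp ((t * y j) * x j)) := by
      rw [← ENNReal.ofReal_prod_of_nonneg fun _ _ => (exp_pos _).le, ← exp_sum, Finset.mul_sum]
      congr 2
      exact Finset.sum_congr rfl fun j _ => by ring
    simp_rw [h]
    rw [lintegral_pi_prod_eval _ (fun j x => ENNReal.ofReal (exp ((t * y j) * x)))
      (fun j => by fun_prop)]
    refine Finset.prod_congr rfl fun j _ => ?_
    rw [lintegral_exp_mul_gaussianReal]
    congr 2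
    ring
  simp_rw [inner]
  rw [lintegral_pi_prod_eval _ (fun _ y => ENNReal.ofReal (exp ((v * t ^ 2 / 2) * y ^ 2)))
    (fun j => by fun_prop), Finset.prod_const, Finset.card_univ, exp_nat_mul,
    ENNReal.ofReal_pow (exp_pos _).le]
  gcongr
  refine (lintegral_exp_mul_sq_gaussianReal_le hw (by positivity) ?_).trans_eq ?_
  · linarith
  · congr 2
    ring

/-- Lemma A.8: concentration of the inner product between two independent random
Gaussian vectors. -/
theorem inner_two_gaussians_concentration
    (d : ℕ) (hd : 0 < d) (σ₁ σ₂ : ℝ) (hσ₁ : 0 < σ₁) (hσ₂ : 0 < σ₂)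
    (Ω : Type) [MeasureSpace Ω] [IsProbabilityMeasure (ℙ : Measure Ω)]
    (u e : Ω → (Fin d → ℝ))
    (hu : Measure.map u ℙ =
      Measure.pi (fun _ : Fin d => gaussianReal 0 ⟨σ₁ ^ 2, sq_nonneg σ₁⟩))
    (he : Measure.map e ℙ =
      Measure.pi (fun _ : Fin d => gaussianReal 0 ⟨σ₂ ^ 2, sq_nonneg σ₂⟩))
    (hindep : IndepFun u e ℙ)
    (δ : ℝ) (hδ₀ : 0 < δ) (hδ₁ : δ < 1 / 10) :
    (ℙ {ω : Ω |
      10 ^ 4 * σ₁ * σ₂ * Real.sqrt d * Real.log (d / δ) ^ 2 ≤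
        |∑ j, u ω j * e ω j|}).toReal ≤ δ := by
  have hprob (v : ℝ≥0) :
      IsProbabilityMeasure (Measure.pi fun _ : Fin d => gaussianReal 0 v) := inferInstance
  have hum : AEMeasurable u ℙ := aemeasurable_of_map_neZero (by
    rw [hu]; exact ⟨(hprob _).ne_zero⟩)
  have hem : AEMeasurable e ℙ := aemeasurable_of_map_neZero (by
    rw [he]; exact ⟨(hprob _).ne_zero⟩)
  have hjoint := hindep.map_prod_eq_prod_map_map hum hem
  rw [hu, he] at hjoint
  set S : Ω → ℝ := fun ω => ∑ j, u ω j * e ω j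
  have hd' : (1 : ℝ) ≤ d := by exact_mod_cast hd
  have hsd : 0 < √(d : ℝ) := sqrt_pos.2 (by linarith)
  set L := Real.log (d / δ) with hL
  set T := 10 ^ 4 * σ₁ * σ₂ * √(d : ℝ) * L ^ 2 with hT
  set t := (2 * σ₁ * σ₂ * √(d : ℝ))⁻¹ with ht
  have ht₀ : 0 < t := by positivity
  have htT : t * T = 5000 * L ^ 2 := by
    rw [ht, hT]; field_simp; ring
  have hvar : σ₁ ^ 2 * σ₂ ^ 2 * t ^ 2 = 1 / (4 * d) := by
    rw [ht, inv_pow, mul_pow, sq_sqrt (by linarith)]; field_simp; ring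
  have hmgf (s : ℝ) (hs : s ^ 2 = t ^ 2) :
      ∫⁻ ω, ENNReal.ofReal (exp (s * S ω)) ∂ℙ ≤ ENNReal.ofReal (exp (1 / 4)) := by
    have hle : σ₁ ^ 2 * σ₂ ^ 2 * s ^ 2 ≤ 1 / 2 := by
      rw [hs, hvar, div_le_div_iff₀ (by positivity) (by norm_num)]; linarith
    have h := lintegral_exp_inner_gaussian_le (ι := Fin d) ⟨σ₁ ^ 2, sq_nonneg σ₁⟩
      (w := ⟨σ₂ ^ 2, sq_nonneg σ₂⟩) (t := s)
      (fun h => (pow_pos hσ₂ 2).ne' (congrArg NNReal.toReal h)) hle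
    rw [← hjoint, lintegral_map' (by fun_prop) (hum.prodMk hem)] at h
    refine h.trans_eq ?_
    congr 2
    change (Fintype.card (Fin d) : ℝ) * (σ₁ ^ 2 * σ₂ ^ 2 * s ^ 2) = 1 / 4
    rw [hs, hvar, Fintype.card_fin]
    field_simp
  have hSm : AEMeasurable S ℙ := by
    have : Measurable fun p : (Fin d → ℝ) × (Fin d → ℝ) => ∑ j, p.1 j * p.2 j := by fun_prop
    exact this.comp_aemeasurable (hum.prodMk hem)
  have tail (s : ℝ) (hs : s ^ 2 = t ^ 2) :
      ℙ {ω | t * T ≤ s * S ω} ≤ ENNReal.ofReal (exp (1 / 4 - t * T)) := by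
    have hM := meas_ge_le_lintegral_div (μ := (ℙ : Measure Ω))
      (f := fun ω => ENNReal.ofReal (exp (s * S ω)))
      (by fun_prop) (ε := ENNReal.ofReal (exp (t * T)))
      (by simpa using exp_pos _) ENNReal.ofReal_ne_top
    simp only [ENNReal.ofReal_le_ofReal_iff (exp_pos _).le, exp_le_exp] at hM
    refine hM.trans ?_
    rw [exp_sub, ENNReal.ofReal_div_of_pos (exp_pos _)]
    gcongr
    exact hmgf s hs
  have hsub : {ω | T ≤ |S ω|} ⊆ {ω | t * T ≤ t * S ω} ∪ {ω | t * T ≤ (-t) * S ω} := by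
    intro ω hω
    rcases le_abs.1 (show T ≤ |S ω| from hω) with h | h
    · exact Or.inl (mul_le_mul_of_nonneg_left h ht₀.le)
    · refine Or.inr ?_
      have := mul_le_mul_of_nonneg_left h ht₀.le
      simpa using this
  have hexp : 2 * exp (1 / 4 - t * T) ≤ δ := by
    have hδL : exp (-L) ≤ δ := by
      rw [exp_neg, hL, exp_log (by positivity), inv_div]
      exact div_le_self hδ₀.le hd'
    have hL1 : 1 ≤ L := by
      rw [hL, le_log_iff_exp_le (by positivity), le_div_iff₀ hδ₀]
      nlinarith [exp_one_lt_d9]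
    calc 2 * exp (1 / 4 - t * T) ≤ exp 1 * exp (-1 - L) := by
          refine mul_le_mul ?_ (exp_le_exp.2 ?_) (exp_pos _).le (exp_pos _).le
          · linarith [add_one_le_exp (1 : ℝ)]
          · rw [htT]; nlinarith
      _ = exp (-L) := by rw [← exp_add]; ring_nf
      _ ≤ δ := hδL
  refine ENNReal.toReal_le_of_le_ofReal hδ₀.le ?_
  calc ℙ {ω | T ≤ |S ω|}
      ≤ ℙ {ω | t * T ≤ t * S ω} + ℙ {ω | t * T ≤ (-t) * S ω} :=
        (measure_mono hsub).trans (measure_union_le _ _)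
    _ ≤ ENNReal.ofReal (exp (1 / 4 - t * T)) + ENNReal.ofReal (exp (1 / 4 - t * T)) :=
        add_le_add (tail t rfl) (tail (-t) (neg_sq t))
    _ = ENNReal.ofReal (2 * exp (1 / 4 - t * T)) := by
        rw [← ENNReal.ofReal_add (exp_pos _).le (exp_pos _).le, two_mul]
    _ ≤ ENNReal.ofReal δ := ENNReal.ofReal_le_ofReal hexp
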